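/- arXiv:1607.05222 — 2 statements merged into one kernel-verified Lean document; each statement's English description precedes it below -/
import Mathlib

section
/- Fix an integer k ≥ 2 and μ > 0 with μ > 2k·√(log k/(k−1)). Then detection and reconstruction are information-theoretically possible in the submatrix localization model: (i) there exists a sequence of measurable sets A_n of symmetric n×n matrices (along n divisible by k) such that Q_n(A_n) → 0 and P_n(A_n) → 1; and (ii) there exist ε > 0, C > 0 and measurable estimators M̂_n(X) such that E_{P_n}‖M̂_n‖_F² ≤ C·n and liminf_{n→∞} (1/n)·E_{P_n}⟨M, M̂_n(X)⟩ ≥ ε, where M = (μ/√n)(Y − J/k) is the planted signal and ⟨A,B⟩ = Tr(A^⊤B). -/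
open MeasureTheory ProbabilityTheory Filter Matrix
open scoped ENNReal

noncomputable instance (m n : ℕ) : MeasurableSpace (Matrix (Fin m) (Fin n) ℝ) :=
  MeasurableSpace.pi

/-- Law of an `n × n` Wigner matrix: symmetric, independent entries on the upper triangle,
`N(0,2)` on the diagonal and `N(0,1)` off the diagonal. -/
noncomputable def wigner (n : ℕ) : Measure (Matrix (Fin n) (Fin n) ℝ) :=
  Measure.map (fun g : Fin n × Fin n → ℝ =>
      Matrix.of fun i j => if i ≤ j then g (i, j) else g (j, i))
    (Measure.pi fun p : Fin n × Fin n => gaussianReal 0 (if p.1 = p.2 then 2 else 1))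

/-- Balanced partitions of `[n]` into `k` parts, each of size `n/k`. -/
def balancedParts (k n : ℕ) : Finset (Fin n → Fin k) :=
  Finset.univ.filter fun σ => ∀ t, (Finset.univ.filter fun i => σ i = t).card = n / k

/-- The planted signal matrix `M = (μ/√n) (Y - J/k)` where `Y_{ij} = 1{σ(i)=σ(j)}`
and `J` is the all-ones matrix. -/
noncomputable def submatrixSignal (μ : ℝ) (k : ℕ) {n : ℕ} (σ : Fin n → Fin k) :
    Matrix (Fin n) (Fin n) ℝ :=
  (μ / Real.sqrt n) •
    Matrix.of (fun i j => (if σ i = σ j then (1 : ℝ) else 0) - 1 / k)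

/-- The planted model `P_n`: the law of `X = (μ/√n)(Y - J/k) + W` with `σ` a uniformly
random balanced partition and `W` an independent Wigner matrix. -/
noncomputable def submatrixPlanted (μ : ℝ) (k n : ℕ) : Measure (Matrix (Fin n) (Fin n) ℝ) :=
  ((balancedParts k n).card : ℝ≥0∞)⁻¹ •
    ∑ σ ∈ balancedParts k n, (wigner n).map (fun W => submatrixSignal μ k σ + W)

/-- The null model `Q_n`: the law of `X = W`. -/
noncomputable def submatrixNull (n : ℕ) : Measure (Matrix (Fin n) (Fin n) ℝ) := wigner n

/-- The joint expectation `E_{M,X} ⟨M, M̂(X)⟩` with `⟨A,B⟩ = Tr(Aᵀ B)`. -/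
noncomputable def submatrixCorr (μ : ℝ) (k n : ℕ)
    (Mh : Matrix (Fin n) (Fin n) ℝ → Matrix (Fin n) (Fin n) ℝ) : ℝ :=
  ((balancedParts k n).card : ℝ)⁻¹ *
    ∑ σ ∈ balancedParts k n,
      ∫ W, Matrix.trace ((submatrixSignal μ k σ)ᵀ * Mh (submatrixSignal μ k σ + W)) ∂(wigner n)

/-- "Along `n` divisible by `k`". -/
def validSub (k : ℕ) : Filter ℕ := atTop ⊓ 𝓟 {n : ℕ | k ∣ n}

section Matrices

variable {n : ℕ}

theorem trace_transpose_mul_eq_sum (A B : Matrix (Fin n) (Fin n) ℝ) :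
    trace (Aᵀ * B) = ∑ i, ∑ j, A i j * B i j := by
  rw [Finset.sum_comm]
  simp [trace, mul_apply]

theorem trace_transpose_mul_comm (A B : Matrix (Fin n) (Fin n) ℝ) :
    trace (Aᵀ * B) = trace (Bᵀ * A) := by
  simp only [trace_transpose_mul_eq_sum, mul_comm]

theorem measurable_entry (i j : Fin n) :
    Measurable fun X : Matrix (Fin n) (Fin n) ℝ => X i j :=
  (measurable_pi_apply j).comp (measurable_pi_apply i)

theorem measurable_matrix_of_entries {α : Type*} [MeasurableSpace α]
    {f : α → Matrix (Fin n) (Fin n) ℝ} (hf : ∀ i j, Measurable fun a => f a i j) :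
    Measurable f :=
  measurable_pi_iff.2 fun i => measurable_pi_iff.2 fun j => hf i j

theorem measurable_const_add_matrix (M : Matrix (Fin n) (Fin n) ℝ) :
    Measurable fun W : Matrix (Fin n) (Fin n) ℝ => M + W :=
  measurable_matrix_of_entries fun i j => (measurable_entry i j).const_add (M i j)

theorem measurable_trace_transpose_mul (A : Matrix (Fin n) (Fin n) ℝ) :
    Measurable fun X : Matrix (Fin n) (Fin n) ℝ => trace (Aᵀ * X) := by
  simp only [trace_transpose_mul_eq_sum]
  exact Finset.measurable_sum _ fun i _ => Finset.measurable_sum _ fun j _ =>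
    (measurable_entry i j).const_mul _

end Matrices

section Wigner

variable {n : ℕ}

theorem measurable_symmetrize :
    Measurable fun g : Fin n × Fin n → ℝ =>
      (Matrix.of fun i j => if i ≤ j then g (i, j) else g (j, i) :
        Matrix (Fin n) (Fin n) ℝ) := by
  refine measurable_matrix_of_entries fun i j => ?_
  simp only [of_apply]
  split_ifs <;> exact measurable_pi_apply _

instance isProbabilityMeasure_wigner : IsProbabilityMeasure (wigner n) :=
  Measure.isProbabilityMeasure_map measurable_symmetrize.aemeasurable

/-- The coefficients of the linear form `⟨A, W⟩` in the independent upper triangular entries. -/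
def upperCoeff (A : Matrix (Fin n) (Fin n) ℝ) (p : Fin n × Fin n) : ℝ :=
  ((if p.1 ≤ p.2 then 1 else 0) + if p.1 < p.2 then 1 else 0) * A p.1 p.2

theorem trace_transpose_mul_symmetrize {A : Matrix (Fin n) (Fin n) ℝ} (hA : A.IsSymm)
    (g : Fin n × Fin n → ℝ) :
    trace (Aᵀ * Matrix.of fun i j => if i ≤ j then g (i, j) else g (j, i)) =
      ∑ p, upperCoeff A p * g p := by
  have hswap : ∑ i, ∑ j, (if i < j then A i j * g (i, j) else 0) =
      ∑ i, ∑ j, (if j < i then A i j * g (j, i) else 0) := by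
    rw [Finset.sum_comm]
    simp only [hA.apply]
  rw [trace_transpose_mul_eq_sum, Fintype.sum_prod_type]
  have h : ∀ i j, upperCoeff A (i, j) * g (i, j) =
      (if i ≤ j then A i j * g (i, j) else 0) + if i < j then A i j * g (i, j) else 0 := by
    intro i j
    simp only [upperCoeff]
    split_ifs <;> ring
  simp only [h, Finset.sum_add_distrib]
  rw [hswap]
  simp only [← Finset.sum_add_distrib, of_apply]
  refine Finset.sum_congr rfl fun i _ => Finset.sum_congr rfl fun j _ => ?_
  rcases le_or_gt i j with hij | hij
  · simp [hij, hij.not_gt]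
  · simp [hij, hij.not_ge]

theorem sum_variance_upperCoeff {A : Matrix (Fin n) (Fin n) ℝ} (hA : A.IsSymm) :
    ∑ p : Fin n × Fin n,
      ((if p.1 = p.2 then 2 else 1 : NNReal) : ℝ) * upperCoeff A p ^ 2 / 2 =
      ∑ i, ∑ j, A i j ^ 2 := by
  have hswap : ∑ i, ∑ j, (if i < j then A i j ^ 2 else 0) =
      ∑ i, ∑ j, (if j < i then A i j ^ 2 else 0) := by
    rw [Finset.sum_comm]
    simp only [hA.apply]
  rw [Fintype.sum_prod_type]
  have h : ∀ i j, ((if i = j then 2 else 1 : NNReal) : ℝ) * upperCoeff A (i, j) ^ 2 / 2 =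
      (if i ≤ j then A i j ^ 2 else 0) + if i < j then A i j ^ 2 else 0 := by
    intro i j
    simp only [upperCoeff]
    rcases lt_trichotomy i j with hij | hij | hij
    · simp only [hij, hij.ne, hij.le, if_true, if_false, NNReal.coe_one]
      ring
    · subst hij
      simp
    · simp [hij.not_ge, hij.not_gt]
  simp only [h, Finset.sum_add_distrib]
  rw [hswap]
  simp only [← Finset.sum_add_distrib]
  refine Finset.sum_congr rfl fun i _ => Finset.sum_congr rfl fun j _ => ?_
  rcases le_or_gt i j with hij | hij
  · simp [hij, hij.not_gt]
  · simp [hij, hij.not_ge]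

theorem integrable_exp_trace_wigner {A : Matrix (Fin n) (Fin n) ℝ} (hA : A.IsSymm) (t : ℝ) :
    Integrable (fun W => Real.exp (t * trace (Aᵀ * W))) (wigner n) := by
  have hm : Measurable fun W : Matrix (Fin n) (Fin n) ℝ => Real.exp (t * trace (Aᵀ * W)) :=
    ((measurable_trace_transpose_mul A).const_mul t).exp
  rw [wigner, integrable_map_measure hm.aestronglyMeasurable measurable_symmetrize.aemeasurable]
  simp only [Function.comp_def, trace_transpose_mul_symmetrize hA, Finset.mul_sum, Real.exp_sum]
  refine Integrable.fintype_prod (f := fun p x => Real.exp (t * (upperCoeff A p * x)))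
    fun p => ?_
  simpa only [mul_assoc] using
    integrable_exp_mul_gaussianReal (μ := 0) (t * upperCoeff A p)

theorem mgf_trace_wigner {A : Matrix (Fin n) (Fin n) ℝ} (hA : A.IsSymm) (t : ℝ) :
    mgf (fun W => trace (Aᵀ * W)) (wigner n) t =
      Real.exp (t ^ 2 * ∑ i, ∑ j, A i j ^ 2) := by
  have hm : Measurable fun W : Matrix (Fin n) (Fin n) ℝ => Real.exp (t * trace (Aᵀ * W)) :=
    ((measurable_trace_transpose_mul A).const_mul t).exp
  rw [mgf, wigner, integral_map measurable_symmetrize.aemeasurable hm.aestronglyMeasurable,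
    ← sum_variance_upperCoeff hA]
  simp only [trace_transpose_mul_symmetrize hA, Finset.mul_sum, Real.exp_sum]
  rw [integral_fintype_prod_eq_prod (fun p x => Real.exp (t * (upperCoeff A p * x)))]
  refine Finset.prod_congr rfl fun p _ => ?_
  have := congrFun (mgf_id_gaussianReal (μ := 0) (v := if p.1 = p.2 then 2 else 1))
    (t * upperCoeff A p)
  simp only [mgf, id, mul_assoc] at this
  rw [this]
  ring_nf

end Wigner

section Signal

variable {k n : ℕ}

theorem submatrixSignal_apply (μ : ℝ) (σ : Fin n → Fin k) (i j : Fin n) :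
    submatrixSignal μ k σ i j =
      μ / Real.sqrt n * ((if σ i = σ j then (1 : ℝ) else 0) - 1 / k) := by
  simp [submatrixSignal]

theorem submatrixSignal_isSymm (μ : ℝ) (σ : Fin n → Fin k) :
    (submatrixSignal μ k σ).IsSymm := by
  ext i j
  simp only [transpose_apply, submatrixSignal_apply, eq_comm]

theorem sum_sq_submatrixSignal (μ : ℝ) (hk : 2 ≤ k) (hkn : k ∣ n) {σ : Fin n → Fin k}
    (hσ : σ ∈ balancedParts k n) :
    ∑ i, ∑ j, submatrixSignal μ k σ i j ^ 2 = μ ^ 2 * (k - 1) / k ^ 2 * n := by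
  have hk0 : (k : ℝ) ≠ 0 := by positivity
  have hcard : ∀ t, (Finset.univ.filter fun i => σ i = t).card = n / k := by
    simpa [balancedParts] using hσ
  have hrow : ∀ i, ∑ j, (if σ i = σ j then (1 : ℝ) else 0) = n / k := by
    intro i
    simp only [eq_comm (a := σ i)]
    rw [Finset.sum_boole, hcard, Nat.cast_div hkn hk0]
  have h : ∀ i j, submatrixSignal μ k σ i j ^ 2 = (μ / Real.sqrt n) ^ 2 *
      ((if σ i = σ j then (1 : ℝ) else 0) * (1 - 2 / k) + 1 / k ^ 2) := by
    intro i j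
    rw [submatrixSignal_apply]
    split_ifs <;> field_simp <;> ring
  simp only [h, ← Finset.mul_sum, Finset.sum_add_distrib, ← Finset.sum_mul, hrow]
  rcases Nat.eq_zero_or_pos n with rfl | hn
  · simp
  · have : (n : ℝ) ≠ 0 := by positivity
    simp only [div_pow, Real.sq_sqrt (Nat.cast_nonneg n), Finset.sum_const, Finset.card_univ,
      Fintype.card_fin, nsmul_eq_mul]
    field_simp
    ring

theorem sq_submatrixSignal_le (μ : ℝ) (hk : 2 ≤ k) (σ : Fin n → Fin k) (i j : Fin n) :
    submatrixSignal μ k σ i j ^ 2 ≤ μ ^ 2 / n := by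
  have hk1 : (1 : ℝ) / k ≤ 1 := by
    rw [div_le_one (by positivity)]
    exact_mod_cast (by lia : 1 ≤ k)
  have hk0 : (0 : ℝ) ≤ 1 / k := by positivity
  rw [submatrixSignal_apply, mul_pow, div_pow, Real.sq_sqrt (Nat.cast_nonneg n)]
  refine mul_le_of_le_one_right (by positivity) ?_
  split_ifs <;> nlinarith

theorem sum_sq_submatrixSignal_le (μ : ℝ) (hk : 2 ≤ k) (σ : Fin n → Fin k) :
    ∑ i, ∑ j, submatrixSignal μ k σ i j ^ 2 ≤ μ ^ 2 * n := by
  calc ∑ i, ∑ j, submatrixSignal μ k σ i j ^ 2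
      ≤ ∑ _i : Fin n, ∑ _j : Fin n, μ ^ 2 / n :=
        Finset.sum_le_sum fun i _ => Finset.sum_le_sum fun j _ => sq_submatrixSignal_le μ hk σ i j
    _ = μ ^ 2 * n := by
        rcases Nat.eq_zero_or_pos n with rfl | hn
        · simp
        · simp only [Finset.sum_const, Finset.card_univ, Fintype.card_fin, nsmul_eq_mul]
          field_simp

theorem abs_trace_submatrixSignal_le (μ : ℝ) (hk : 2 ≤ k) (σ τ : Fin n → Fin k) :
    |trace ((submatrixSignal μ k σ)ᵀ * submatrixSignal μ k τ)| ≤ μ ^ 2 * n := by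
  rw [trace_transpose_mul_eq_sum]
  have hσ := sum_sq_submatrixSignal_le μ hk σ
  have hτ := sum_sq_submatrixSignal_le μ hk τ
  calc |∑ i, ∑ j, submatrixSignal μ k σ i j * submatrixSignal μ k τ i j|
      ≤ ∑ i, ∑ j, |submatrixSignal μ k σ i j * submatrixSignal μ k τ i j| :=
        (Finset.abs_sum_le_sum_abs _ _).trans
          (Finset.sum_le_sum fun i _ => Finset.abs_sum_le_sum_abs _ _)
    _ ≤ ∑ i, ∑ j, (submatrixSignal μ k σ i j ^ 2 + submatrixSignal μ k τ i j ^ 2) / 2 := by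
        refine Finset.sum_le_sum fun i _ => Finset.sum_le_sum fun j _ => ?_
        rw [abs_mul, ← sq_abs (submatrixSignal μ k σ i j), ← sq_abs (submatrixSignal μ k τ i j)]
        linarith [two_mul_le_add_sq |submatrixSignal μ k σ i j| |submatrixSignal μ k τ i j|]
    _ = (∑ i, ∑ j, submatrixSignal μ k σ i j ^ 2 +
          ∑ i, ∑ j, submatrixSignal μ k τ i j ^ 2) / 2 := by
        simp only [← Finset.sum_div, Finset.sum_add_distrib]
    _ ≤ μ ^ 2 * n := by linarith

theorem balancedParts_nonempty (hk : 2 ≤ k) (hkn : k ∣ n) : (balancedParts k n).Nonempty := by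
  obtain ⟨m, rfl⟩ := hkn
  rw [mul_comm k m]
  refine ⟨fun i => (finProdFinEquiv.symm i).2, ?_⟩
  simp only [balancedParts, Finset.mem_filter, Finset.mem_univ, true_and]
  intro t
  rw [Nat.mul_div_cancel _ (by lia)]
  calc (Finset.univ.filter fun i : Fin (m * k) => (finProdFinEquiv.symm i).2 = t).card
      = (Finset.univ.filter fun p : Fin m × Fin k => p.2 = t).card :=
        Finset.card_equiv finProdFinEquiv.symm (by simp)
    _ = ((Finset.univ : Finset (Fin m)) ×ˢ {t}).card := by
        congr 1
        ext ⟨a, b⟩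
        simp [eq_comm]
    _ = m := by simp

theorem card_balancedParts_le : (balancedParts k n).card ≤ k ^ n := by
  simpa using Finset.card_le_univ (balancedParts k n)

theorem planted_le_of_forall {μ : ℝ} {B : Set (Matrix (Fin n) (Fin n) ℝ)}
    (hB : MeasurableSet B) {c : ℝ≥0∞}
    (h : ∀ σ ∈ balancedParts k n, wigner n {W | submatrixSignal μ k σ + W ∈ B} ≤ c) :
    submatrixPlanted μ k n B ≤ c := by
  simp only [submatrixPlanted, Measure.smul_apply, Measure.finsetSum_apply, smul_eq_mul]
  calc ((balancedParts k n).card : ℝ≥0∞)⁻¹ *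
        ∑ σ ∈ balancedParts k n, (wigner n).map (fun W => submatrixSignal μ k σ + W) B
      ≤ ((balancedParts k n).card : ℝ≥0∞)⁻¹ * ∑ _σ ∈ balancedParts k n, c := by
        gcongr with σ hσ
        rw [Measure.map_apply (measurable_const_add_matrix _) hB]
        exact h σ hσ
    _ = ((balancedParts k n).card : ℝ≥0∞)⁻¹ * (balancedParts k n).card * c := by
        rw [Finset.sum_const, nsmul_eq_mul, mul_assoc]
    _ ≤ 1 * c := by
        gcongr
        exact ENNReal.inv_mul_le_one _
    _ = c := one_mul c

theorem isProbabilityMeasure_submatrixPlanted (μ : ℝ) (hk : 2 ≤ k) (hkn : k ∣ n) :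
    IsProbabilityMeasure (submatrixPlanted μ k n) := by
  constructor
  have hc : ((balancedParts k n).card : ℝ≥0∞) ≠ 0 := by
    exact_mod_cast (balancedParts_nonempty hk hkn).card_pos.ne'
  have hp : ∀ σ : Fin n → Fin k,
      (wigner n).map (fun W => submatrixSignal μ k σ + W) Set.univ = 1 := fun σ => by
    rw [Measure.map_apply (measurable_const_add_matrix _) MeasurableSet.univ]
    simp
  simp only [submatrixPlanted, Measure.smul_apply, Measure.finsetSum_apply, smul_eq_mul, hp,
    Finset.sum_const, nsmul_eq_mul, mul_one]
  exact ENNReal.inv_mul_cancel hc (ENNReal.natCast_ne_top _)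

end Signal

/-- A maximizer of finitely many measurable functions can be chosen measurably. -/
theorem exists_measurable_argmax {α ι : Type*} [MeasurableSpace α] [MeasurableSpace ι]
    {f : ι → α → ℝ} (hf : ∀ i, Measurable (f i)) {S : Finset ι} (hS : S.Nonempty) :
    ∃ s : α → ι, Measurable s ∧ ∀ x, s x ∈ S ∧ ∀ i ∈ S, f i x ≤ f (s x) x := by
  classical
  induction hS using Finset.Nonempty.cons_induction with
  | singleton a => exact ⟨fun _ => a, measurable_const, by simp⟩
  | cons a S ha hS ih =>
    obtain ⟨s, hs, hmax⟩ := ih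
    have hsup : ∀ x, f (s x) x = S.sup' hS fun i => f i x := fun x =>
      le_antisymm (Finset.le_sup' (fun i => f i x) (hmax x).1)
        (Finset.sup'_le hS _ (hmax x).2)
    have hmeas : Measurable fun x => f (s x) x := by
      simp only [hsup]
      have h := Finset.measurable_sup' hS (fun i _ => hf i)
      convert h using 1
      ext x
      simp
    refine ⟨fun x => if f (s x) x ≤ f a x then a else s x,
      Measurable.ite (measurableSet_le hmeas (hf a)) measurable_const hs, fun x => ?_⟩
    by_cases hx : f (s x) x ≤ f a x
    · simp only [hx, if_true, Finset.mem_cons, true_or, true_and, forall_eq_or_imp, le_refl]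
      exact fun i hi => ((hmax x).2 i hi).trans hx
    · simp only [hx, if_false, Finset.mem_cons, (hmax x).1, or_true, true_and,
        forall_eq_or_imp]
      exact ⟨(not_le.1 hx).le, (hmax x).2⟩

section Scan

variable {k n : ℕ}

/-- The matrices whose correlation with some balanced signal is at least `r`. -/
def scanSet (μ : ℝ) (k n : ℕ) (r : ℝ) : Set (Matrix (Fin n) (Fin n) ℝ) :=
  ⋃ σ ∈ balancedParts k n, {X | r ≤ trace ((submatrixSignal μ k σ)ᵀ * X)}

theorem measurableSet_scanSet (μ : ℝ) (k n : ℕ) (r : ℝ) : MeasurableSet (scanSet μ k n r) :=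
  Finset.measurableSet_biUnion _ fun _ _ =>
    measurableSet_le measurable_const (measurable_trace_transpose_mul _)

theorem wigner_real_scanSet_le (μ : ℝ) (hk : 2 ≤ k) (hkn : k ∣ n) (r : ℝ) {t : ℝ} (ht : 0 ≤ t) :
    (wigner n).real (scanSet μ k n r) ≤
      Real.exp (n * Real.log k - t * r + t ^ 2 * (μ ^ 2 * (k - 1) / k ^ 2 * n)) := by
  have hk0 : (0 : ℝ) < k := by positivity
  have hexp : Real.exp (n * Real.log k) = (k : ℝ) ^ n := by
    rw [Real.exp_nat_mul, Real.exp_log hk0]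
  calc (wigner n).real (scanSet μ k n r)
      ≤ ∑ σ ∈ balancedParts k n,
          (wigner n).real {X | r ≤ trace ((submatrixSignal μ k σ)ᵀ * X)} :=
        measureReal_biUnion_finset_le _ _
    _ ≤ ∑ _σ ∈ balancedParts k n,
          Real.exp (-t * r) * Real.exp (t ^ 2 * (μ ^ 2 * (k - 1) / k ^ 2 * n)) := by
        refine Finset.sum_le_sum fun σ hσ => ?_
        rw [← sum_sq_submatrixSignal μ hk hkn hσ,
          ← mgf_trace_wigner (submatrixSignal_isSymm μ σ)]
        exact measure_ge_le_exp_mul_mgf _ ht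
          (integrable_exp_trace_wigner (submatrixSignal_isSymm μ σ) t)
    _ ≤ (k : ℝ) ^ n * (Real.exp (-t * r) * Real.exp (t ^ 2 * (μ ^ 2 * (k - 1) / k ^ 2 * n))) := by
        rw [Finset.sum_const, nsmul_eq_mul]
        gcongr
        exact_mod_cast card_balancedParts_le
    _ = _ := by
        rw [← hexp, ← Real.exp_add, ← Real.exp_add]
        ring_nf

theorem planted_compl_scanSet_le (μ : ℝ) (hk : 2 ≤ k) (hkn : k ∣ n) (r : ℝ) {t : ℝ}
    (ht : 0 ≤ t) :
    submatrixPlanted μ k n (scanSet μ k n r)ᶜ ≤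
      ENNReal.ofReal (Real.exp (t * (r - μ ^ 2 * (k - 1) / k ^ 2 * n) +
        t ^ 2 * (μ ^ 2 * (k - 1) / k ^ 2 * n))) := by
  refine planted_le_of_forall (measurableSet_scanSet μ k n r).compl fun σ hσ => ?_
  have hfrob := sum_sq_submatrixSignal μ hk hkn hσ
  calc wigner n {W | submatrixSignal μ k σ + W ∈ (scanSet μ k n r)ᶜ}
      ≤ wigner n {W | trace ((submatrixSignal μ k σ)ᵀ * W) ≤
          r - μ ^ 2 * (k - 1) / k ^ 2 * n} := by
        refine measure_mono fun W hW => ?_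
        simp only [scanSet, Set.mem_ofPred_eq, Set.mem_compl_iff, Set.mem_iUnion, not_exists,
          not_le] at hW ⊢
        have := hW σ hσ
        rw [mul_add, trace_add, trace_transpose_mul_eq_sum _ (submatrixSignal μ k σ)] at this
        simp only [← pow_two, hfrob] at this
        linarith
    _ ≤ _ := by
        rw [← ofReal_measureReal]
        refine ENNReal.ofReal_le_ofReal ?_
        refine (measure_le_le_exp_mul_mgf _ (neg_nonpos.2 ht)
          (integrable_exp_trace_wigner (submatrixSignal_isSymm μ σ) (-t))).trans_eq ?_
        rw [mgf_trace_wigner (submatrixSignal_isSymm μ σ), hfrob, ← Real.exp_add]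
        ring_nf

end Scan

section Estimator

variable {k n : ℕ} {s : Matrix (Fin n) (Fin n) ℝ → Fin n → Fin k}

theorem le_trace_argmax {μ : ℝ} (hk : 2 ≤ k) (hkn : k ∣ n)
    (hmax : ∀ X, s X ∈ balancedParts k n ∧ ∀ σ ∈ balancedParts k n,
      trace ((submatrixSignal μ k σ)ᵀ * X) ≤ trace ((submatrixSignal μ k (s X))ᵀ * X))
    {σ : Fin n → Fin k} (hσ : σ ∈ balancedParts k n) (W : Matrix (Fin n) (Fin n) ℝ) :
    μ ^ 2 * (k - 1) / k ^ 2 * n + trace ((submatrixSignal μ k σ)ᵀ * W) -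
        trace ((submatrixSignal μ k (s (submatrixSignal μ k σ + W)))ᵀ * W) ≤
      trace ((submatrixSignal μ k σ)ᵀ *
        submatrixSignal μ k (s (submatrixSignal μ k σ + W))) := by
  have h := (hmax (submatrixSignal μ k σ + W)).2 σ hσ
  rw [mul_add, mul_add, trace_add, trace_add,
    trace_transpose_mul_eq_sum _ (submatrixSignal μ k σ)] at h
  simp only [← pow_two, sum_sq_submatrixSignal μ hk hkn hσ] at h
  rw [trace_transpose_mul_comm _ (submatrixSignal μ k (s _))]
  linarith

theorem measurable_trace_argmax (μ : ℝ) (hs : Measurable s) (σ : Fin n → Fin k) :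
    Measurable fun W => trace ((submatrixSignal μ k σ)ᵀ *
      submatrixSignal μ k (s (submatrixSignal μ k σ + W))) :=
  (Measurable.of_discrete (f := fun τ : Fin n → Fin k =>
    trace ((submatrixSignal μ k σ)ᵀ * submatrixSignal μ k τ))).comp
      (hs.comp (measurable_const_add_matrix _))

theorem le_integral_trace_argmax {μ : ℝ} (hk : 2 ≤ k) (hkn : k ∣ n) (hs : Measurable s)
    (hmax : ∀ X, s X ∈ balancedParts k n ∧ ∀ σ ∈ balancedParts k n,
      trace ((submatrixSignal μ k σ)ᵀ * X) ≤ trace ((submatrixSignal μ k (s X))ᵀ * X))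
    {σ : Fin n → Fin k} (hσ : σ ∈ balancedParts k n) {t η : ℝ} (ht : 0 < t) (hη : 0 < η) :
    n * (μ ^ 2 * (k - 1) / k ^ 2 * (1 - η - t) - Real.log k / t) ≤
      ∫ W, trace ((submatrixSignal μ k σ)ᵀ *
        submatrixSignal μ k (s (submatrixSignal μ k σ + W))) ∂(wigner n) := by
  have hk0 : (0 : ℝ) < k := by positivity
  set v : ℝ := μ ^ 2 * (k - 1) / k ^ 2 * n with hv
  set F : (Fin n → Fin k) → Matrix (Fin n) (Fin n) ℝ → ℝ :=
    fun σ W => trace ((submatrixSignal μ k σ)ᵀ * W) with hF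
  set a : ℝ := n * Real.log k + t ^ 2 * v with ha
  have hint : ∀ τ u, Integrable (fun W => Real.exp (u * F τ W)) (wigner n) := fun τ u =>
    integrable_exp_trace_wigner (submatrixSignal_isSymm μ τ) u
  have hmgf : ∀ τ ∈ balancedParts k n, ∀ u,
      ∫ W, Real.exp (u * F τ W) ∂(wigner n) = Real.exp (u ^ 2 * v) := fun τ hτ u => by
    rw [hv, ← sum_sq_submatrixSignal μ hk hkn hτ]
    exact mgf_trace_wigner (submatrixSignal_isSymm μ τ) u
  set U : Matrix (Fin n) (Fin n) ℝ → ℝ := fun W => Real.exp (-η * F σ W) with hU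
  set V : Matrix (Fin n) (Fin n) ℝ → ℝ :=
    fun W => ∑ τ ∈ balancedParts k n, Real.exp (t * F τ W) with hV
  have hUint : Integrable U (wigner n) := hint σ (-η)
  have hVint : Integrable V (wigner n) := integrable_finsetSum _ fun τ _ => hint τ t
  have hUval : Real.exp (-(η ^ 2 * v)) * ∫ W, U W ∂(wigner n) = 1 := by
    rw [hU, hmgf σ hσ, ← Real.exp_add]
    simp
  have hVval : Real.exp (-a) * ∫ W, V W ∂(wigner n) ≤ 1 := by
    rw [hV, integral_finsetSum _ fun τ _ => hint τ t, Finset.sum_congr rfl fun τ hτ => hmgf τ hτ t,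
      Finset.sum_const, nsmul_eq_mul]
    calc Real.exp (-a) * ((balancedParts k n).card * Real.exp (t ^ 2 * v))
        ≤ Real.exp (-a) * ((k : ℝ) ^ n * Real.exp (t ^ 2 * v)) := by
          gcongr
          exact_mod_cast card_balancedParts_le
      _ = Real.exp (-a) * Real.exp a := by
          rw [ha, Real.exp_add (n * Real.log k), Real.exp_nat_mul, Real.exp_log hk0]
      _ = 1 := by rw [← Real.exp_add]; simp
  have hpt : ∀ W, v - (η ^ 2 * v - 1) / η - (a - 1) / t -
      Real.exp (-(η ^ 2 * v)) / η * U W - Real.exp (-a) / t * V W ≤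
      trace ((submatrixSignal μ k σ)ᵀ *
        submatrixSignal μ k (s (submatrixSignal μ k σ + W))) := by
    intro W
    refine le_trans ?_ (le_trace_argmax hk hkn hmax hσ W)
    set τ := s (submatrixSignal μ k σ + W)
    have h1 : -η * F σ W ≤ η ^ 2 * v - 1 + Real.exp (-(η ^ 2 * v)) * U W := by
      rw [hU, ← Real.exp_add]
      linarith [Real.add_one_le_exp (-(η ^ 2 * v) + -η * F σ W)]
    have h2 : t * F τ W ≤ a - 1 + Real.exp (-a) * V W := by
      have hle : Real.exp (t * F τ W) ≤ V W :=
        Finset.single_le_sum (f := fun τ => Real.exp (t * F τ W))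
          (fun _ _ => (Real.exp_pos _).le) (hmax _).1
      have := mul_le_mul_of_nonneg_left hle (Real.exp_pos (-a)).le
      rw [← Real.exp_add] at this
      linarith [Real.add_one_le_exp (-a + t * F τ W)]
    have h1' : -F σ W ≤ (η ^ 2 * v - 1) / η + Real.exp (-(η ^ 2 * v)) / η * U W := by
      rw [div_mul_eq_mul_div, ← add_div, le_div_iff₀ hη]
      linarith
    have h2' : F τ W ≤ (a - 1) / t + Real.exp (-a) / t * V W := by
      rw [div_mul_eq_mul_div, ← add_div, le_div_iff₀ ht]
      linarith
    change _ ≤ v + F σ W - F τ W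
    linarith
  have hbound : Integrable (fun W => trace ((submatrixSignal μ k σ)ᵀ *
      submatrixSignal μ k (s (submatrixSignal μ k σ + W)))) (wigner n) :=
    Integrable.of_bound (measurable_trace_argmax μ hs σ).aestronglyMeasurable (μ ^ 2 * n)
      (ae_of_all _ fun W => abs_trace_submatrixSignal_le μ hk _ _)
  have hU' := hUint.const_mul (Real.exp (-(η ^ 2 * v)) / η)
  have hV' := hVint.const_mul (Real.exp (-a) / t)
  refine le_trans ?_ (integral_mono (((integrable_const _).sub hU').sub hV') hbound hpt)
  rw [integral_sub' ((integrable_const _).sub hU') hV', integral_sub' (integrable_const _) hU']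
  simp only [integral_const_mul, integral_const, probReal_univ, one_smul]
  rw [div_mul_eq_mul_div (Real.exp (-(η ^ 2 * v))), hUval,
    div_mul_eq_mul_div (Real.exp (-a))]
  have hV1 := div_le_div_of_nonneg_right hVval ht.le
  have e1 : (η ^ 2 * v - 1) / η + 1 / η = η * v := by field_simp; ring
  have e2 : (a - 1) / t + 1 / t = n * Real.log k / t + t * v := by rw [ha]; field_simp; ring
  have e3 : n * (μ ^ 2 * (k - 1) / k ^ 2 * (1 - η - t) - Real.log k / t) =
      v - η * v - (n * Real.log k / t + t * v) := by rw [hv]; ring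
  rw [e3]
  linarith

end Estimator

theorem tendsto_ofReal_exp_neg_mul {c : ℝ} (hc : 0 < c) :
    Tendsto (fun n : ℕ => ENNReal.ofReal (Real.exp (-(c * n)))) atTop (nhds 0) := by
  rw [← ENNReal.ofReal_zero]
  refine (ENNReal.continuous_ofReal.tendsto 0).comp (Real.tendsto_exp_neg_atTop_nhds_zero.comp ?_)
  exact tendsto_natCast_atTop_atTop.const_mul_atTop hc

instance validSub_neBot (k : ℕ) [NeZero k] : (validSub k).NeBot := by
  rw [validSub, ← frequently_mem_iff_neBot, frequently_atTop]
  exact fun a => ⟨k * a, Nat.le_mul_of_pos_left a (NeZero.pos k), Dvd.intro a rfl⟩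

theorem eventually_validSub {k : ℕ} {p : ℕ → Prop} (h : ∀ n, 0 < n → k ∣ n → p n) :
    ∀ᶠ n in validSub k, p n := by
  rw [validSub, eventually_inf_principal]
  filter_upwards [eventually_gt_atTop 0] with n hn hkn
  exact h n hn hkn

theorem exists_detection {k : ℕ} (hk : 2 ≤ k) {μ l s : ℝ} (hl : 0 < l)
    (hl2 : l ^ 2 = Real.log k) (hs2 : s ^ 2 = μ ^ 2 * (k - 1) / k ^ 2) (hls : 2 * l < s) :
    ∃ A : (n : ℕ) → Set (Matrix (Fin n) (Fin n) ℝ),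
      (∀ n, MeasurableSet (A n)) ∧
      Tendsto (fun n => submatrixNull n (A n)) (validSub k) (nhds 0) ∧
      Tendsto (fun n => submatrixPlanted μ k n (A n)) (validSub k) (nhds 1) := by
  have hs : 0 < s := by linarith
  have hd : 0 < s - 2 * l := by linarith
  have hmono : validSub k ≤ atTop := inf_le_left
  set A : (n : ℕ) → Set (Matrix (Fin n) (Fin n) ℝ) :=
    fun n => scanSet μ k n (s * (s + 2 * l) / 2 * n) with hA
  have hplant : Tendsto (fun n => submatrixPlanted μ k n (A n)ᶜ) (validSub k) (nhds 0) := by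
    refine tendsto_of_tendsto_of_tendsto_of_le_of_le' tendsto_const_nhds
      ((tendsto_ofReal_exp_neg_mul (by positivity : 0 < (s - 2 * l) ^ 2 / 16)).mono_left hmono)
      (Eventually.of_forall fun _ => zero_le) (eventually_validSub fun n _ hkn => ?_)
    refine (planted_compl_scanSet_le μ hk hkn _
      (by positivity : 0 ≤ (s - 2 * l) / (4 * s))).trans_eq ?_
    rw [← hs2]
    congr 2
    field_simp
    ring
  refine ⟨A, fun n => measurableSet_scanSet _ _ _ _, ?_, ?_⟩
  · refine tendsto_of_tendsto_of_tendsto_of_le_of_le' tendsto_const_nhds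
      ((tendsto_ofReal_exp_neg_mul (by positivity : 0 < l * (s - 2 * l) / 2)).mono_left hmono)
      (Eventually.of_forall fun _ => zero_le) (eventually_validSub fun n _ hkn => ?_)
    rw [submatrixNull, ← ofReal_measureReal]
    refine ENNReal.ofReal_le_ofReal ((wigner_real_scanSet_le μ hk hkn _
      (by positivity : 0 ≤ l / s)).trans_eq ?_)
    rw [← hs2, ← hl2]
    congr 1
    field_simp
    ring
  · have h1 := ENNReal.Tendsto.sub (tendsto_const_nhds (x := (1 : ℝ≥0∞))) hplant
      (Or.inl ENNReal.one_ne_top)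
    rw [tsub_zero] at h1
    refine h1.congr' (eventually_validSub fun n _ hkn => ?_)
    have := isProbabilityMeasure_submatrixPlanted μ hk hkn
    rw [← prob_compl_eq_one_sub (measurableSet_scanSet _ _ _ _).compl, compl_compl]

theorem exists_reconstruction {k : ℕ} (hk : 2 ≤ k) {μ l s : ℝ} (hμ : 0 < μ) (hl : 0 < l)
    (hl2 : l ^ 2 = Real.log k) (hs2 : s ^ 2 = μ ^ 2 * (k - 1) / k ^ 2) (hls : 2 * l < s) :
    ∃ ε > (0 : ℝ), ∃ C > (0 : ℝ),
      ∃ Mh : (n : ℕ) → Matrix (Fin n) (Fin n) ℝ → Matrix (Fin n) (Fin n) ℝ,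
      (∀ n, Measurable (Mh n)) ∧
      (∀ n : ℕ, k ∣ n →
        ∫ X, ∑ i, ∑ j, (Mh n X i j) ^ 2 ∂(submatrixPlanted μ k n) ≤ C * n) ∧
      ε ≤ liminf (fun n : ℕ => (n : ℝ)⁻¹ * submatrixCorr μ k n (Mh n)) (validSub k) := by
  have hs : 0 < s := by linarith
  have hd : 0 < s - 2 * l := by linarith
  have : NeZero k := ⟨by lia⟩
  have hsel : ∀ n, ∃ e : Matrix (Fin n) (Fin n) ℝ → Fin n → Fin k, Measurable e ∧ (k ∣ n →
      ∀ X, e X ∈ balancedParts k n ∧ ∀ σ ∈ balancedParts k n,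
        trace ((submatrixSignal μ k σ)ᵀ * X) ≤ trace ((submatrixSignal μ k (e X))ᵀ * X)) := by
    intro n
    by_cases hkn : k ∣ n
    · obtain ⟨e, he, hmax⟩ := exists_measurable_argmax
        (f := fun (σ : Fin n → Fin k) X => trace ((submatrixSignal μ k σ)ᵀ * X))
        (fun σ => measurable_trace_transpose_mul _) (balancedParts_nonempty hk hkn)
      exact ⟨e, he, fun _ => hmax⟩
    · exact ⟨fun _ _ => 0, measurable_const, fun h => absurd h hkn⟩
  choose e he hmax using hsel
  have hcard : ∀ n, k ∣ n → (0 : ℝ) < (balancedParts k n).card := fun n hkn => by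
    exact_mod_cast (balancedParts_nonempty hk hkn).card_pos
  refine ⟨s * (s - 2 * l) / 2, by positivity, μ ^ 2, by positivity,
    fun n X => submatrixSignal μ k (e n X),
    fun n => (Measurable.of_discrete (f := submatrixSignal μ k)).comp (he n),
    fun n hkn => ?_, ?_⟩
  · have := isProbabilityMeasure_submatrixPlanted μ hk hkn
    calc ∫ X, ∑ i, ∑ j, submatrixSignal μ k (e n X) i j ^ 2 ∂(submatrixPlanted μ k n)
        ≤ ∫ _X, μ ^ 2 * n ∂(submatrixPlanted μ k n) :=
          integral_mono_of_nonneg (ae_of_all _ fun X => by positivity) (integrable_const _)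
            (ae_of_all _ fun X => sum_sq_submatrixSignal_le μ hk _)
      _ = μ ^ 2 * n := by simp
  · refine le_liminf_of_le (IsCoboundedUnder.of_frequently_le (a := μ ^ 2)
      (Eventually.frequently (eventually_validSub fun n hn hkn => ?_)))
      (eventually_validSub fun n hn hkn => ?_)
    · rw [inv_mul_le_iff₀ (by positivity), submatrixCorr, inv_mul_le_iff₀ (hcard n hkn),
        ← nsmul_eq_mul (balancedParts k n).card]
      refine Finset.sum_le_card_nsmul _ _ _ fun σ _ => ?_
      refine (Real.le_norm_self _).trans ((norm_integral_le_of_norm_le_const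
        (ae_of_all _ fun W => abs_trace_submatrixSignal_le μ hk σ _)).trans_eq ?_)
      rw [probReal_univ, mul_one, mul_comm]
    · rw [le_inv_mul_iff₀ (by positivity), submatrixCorr, le_inv_mul_iff₀ (hcard n hkn),
        ← nsmul_eq_mul (balancedParts k n).card]
      refine Finset.card_nsmul_le_sum _ _ _ fun σ hσ => ?_
      refine Eq.trans_le ?_ (le_integral_trace_argmax hk hkn (he n) (hmax n hkn) hσ
        (by positivity : 0 < l / s) (by positivity : 0 < (s - 2 * l) / (2 * s)))
      rw [← hs2, ← hl2]
      field_simp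
      ring

/-- **Submatrix localization, first-moment upper bound.**  If `μ > 2k √(log k/(k-1))` then
detection and reconstruction are information-theoretically possible. -/
theorem submatrix_upper (k : ℕ) (hk : 2 ≤ k) (μ : ℝ) (hμ0 : 0 < μ)
    (hthr : 2 * k * Real.sqrt (Real.log k / (k - 1)) < μ) :
    -- (i) detection is possible
    (∃ A : (n : ℕ) → Set (Matrix (Fin n) (Fin n) ℝ),
      (∀ n, MeasurableSet (A n)) ∧
      Tendsto (fun n => submatrixNull n (A n)) (validSub k) (nhds 0) ∧
      Tendsto (fun n => submatrixPlanted μ k n (A n)) (validSub k) (nhds 1)) ∧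
    -- (ii) reconstruction is possible
    (∃ ε > (0 : ℝ), ∃ C > (0 : ℝ),
      ∃ Mh : (n : ℕ) → Matrix (Fin n) (Fin n) ℝ → Matrix (Fin n) (Fin n) ℝ,
      (∀ n, Measurable (Mh n)) ∧
      (∀ n : ℕ, k ∣ n →
        ∫ X, ∑ i, ∑ j, (Mh n X i j) ^ 2 ∂(submatrixPlanted μ k n) ≤ C * n) ∧
      ε ≤ liminf (fun n : ℕ => (n : ℝ)⁻¹ * submatrixCorr μ k n (Mh n)) (validSub k)) := by
  have hk1 : (1 : ℝ) < k := by exact_mod_cast hk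
  have hk' : (0 : ℝ) < k - 1 := by linarith
  have hlog : 0 < Real.log k := Real.log_pos hk1
  have hl : 0 < Real.sqrt (Real.log k) := Real.sqrt_pos.2 hlog
  have hl2 : Real.sqrt (Real.log k) ^ 2 = Real.log k := Real.sq_sqrt hlog.le
  have hs2 : (μ * Real.sqrt (k - 1) / k) ^ 2 = μ ^ 2 * (k - 1) / k ^ 2 := by
    rw [div_pow, mul_pow, Real.sq_sqrt hk'.le]
  have hls : 2 * Real.sqrt (Real.log k) < μ * Real.sqrt (k - 1) / k := by
    rw [Real.sqrt_div hlog.le, ← mul_div_assoc, div_lt_iff₀ (Real.sqrt_pos.2 hk')] at hthr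
    rw [lt_div_iff₀ (by positivity)]
    linarith
  exact ⟨exists_detection hk hl hl2 hs2 hls, exists_reconstruction hk hμ0 hl hl2 hs2 hls⟩
end

section
/- Fix an integer k ≥ 3 and a real ξ with 0 ≤ ξ < 2·log(k−1)/(k−1). Then the function Φ(ω) = H(ω) − log k + (ξ/2)·(‖ω‖_F² − 1) on the set of doubly stochastic k×k matrices is maximized uniquely at ω = J/k; in particular Φ(ω) ≤ 0 for every doubly stochastic k×k matrix ω, with equality if and only if ω = J/k. -/
open Finset

/-- `ω` is a doubly stochastic matrix. -/
def IsDoublyStochastic {k : ℕ} (ω : Matrix (Fin k) (Fin k) ℝ) : Prop :=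
  (∀ s t, 0 ≤ ω s t) ∧ (∀ s, ∑ t, ω s t = 1) ∧ (∀ t, ∑ s, ω s t = 1)

/-- The entropy `H(ω) = -(1/k) Σ_{s,t} ω_{st} log ω_{st}` of a doubly stochastic matrix
(with `0 log 0 = 0`, which holds by the convention `log 0 = 0`). -/
noncomputable def matEntropy {k : ℕ} (ω : Matrix (Fin k) (Fin k) ℝ) : ℝ :=
  -(1 / k) * ∑ s, ∑ t, ω s t * Real.log (ω s t)

/-- The function `Φ(ω) = H(ω) - log k + (ξ/2)(‖ω‖_F² - 1)`. -/
noncomputable def Phi (k : ℕ) (ξ : ℝ) (ω : Matrix (Fin k) (Fin k) ℝ) : ℝ :=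
  matEntropy ω - Real.log k + ξ / 2 * ((∑ s, ∑ t, ω s t ^ 2) - 1)

/-- The logarithm is dominated by the hyperbolic sine of the logarithm. -/
lemma two_mul_log_le_sub_inv {w : ℝ} (hw : 1 ≤ w) : 2 * Real.log w ≤ w - w⁻¹ := by
  have h := Real.self_le_sinh_iff.2 (Real.log_nonneg hw)
  rw [Real.sinh_log (by linarith)] at h
  linarith

lemma two_mul_sub_one_le_mul_log {u : ℝ} (hu : 1 ≤ u) :
    2 * (u - 1) ≤ (u + 1) * Real.log u := by
  have h := Real.le_log_one_add_of_nonneg (sub_nonneg.2 hu)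
  rw [add_sub_cancel, div_le_iff₀ (by linarith)] at h
  linarith

lemma hasDerivAt_add_mul_log (c : ℝ) {w : ℝ} (hw : 0 < w) :
    HasDerivAt (fun w => (w + c) * Real.log w) (Real.log w + 1 + c * w⁻¹) w := by
  refine (((hasDerivAt_id w).add_const c).mul (Real.hasDerivAt_log hw.ne')).congr_deriv ?_
  simp only [id]
  field_simp
  ring

lemma hasDerivAt_log_add_one_add_mul_inv (c : ℝ) {w : ℝ} (hw : 0 < w) :
    HasDerivAt (fun w => Real.log w + 1 + c * w⁻¹) ((w - c) / w ^ 2) w := by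
  refine (((Real.hasDerivAt_log hw.ne').add_const 1).add
    ((hasDerivAt_inv hw.ne').const_mul c)).congr_deriv ?_
  field_simp
  ring

lemma continuousOn_add_mul_log (c : ℝ) {s : Set ℝ} (hs : ∀ w ∈ s, 0 < w) :
    ContinuousOn (fun w => (w + c) * Real.log w) s := fun w hw =>
  (hasDerivAt_add_mul_log c (hs w hw)).continuousAt.continuousWithinAt

lemma concaveOn_add_mul_log (c : ℝ) :
    ConcaveOn ℝ (Set.Icc 1 c) fun w => (w + c) * Real.log w := by
  refine concaveOn_of_hasDerivWithinAt2_nonpos (f' := fun w => Real.log w + 1 + c * w⁻¹)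
    (f'' := fun w => (w - c) / w ^ 2) (convex_Icc _ _)
    (continuousOn_add_mul_log c fun w hw => by linarith [hw.1]) ?_ ?_ ?_ <;>
    rw [interior_Icc] <;> intro w hw
  · exact (hasDerivAt_add_mul_log c (by linarith [hw.1])).hasDerivWithinAt
  · exact (hasDerivAt_log_add_one_add_mul_inv c (by linarith [hw.1])).hasDerivWithinAt
  · exact div_nonpos_of_nonpos_of_nonneg (by linarith [hw.2]) (by positivity)

lemma convexOn_add_one_mul_log :
    ConvexOn ℝ (Set.Ici 1) fun w => (w + 1) * Real.log w := by
  refine convexOn_of_hasDerivWithinAt2_nonneg (f' := fun w => Real.log w + 1 + 1 * w⁻¹)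
    (f'' := fun w => (w - 1) / w ^ 2) (convex_Ici _)
    (continuousOn_add_mul_log 1 fun w hw => lt_of_lt_of_le one_pos hw) ?_ ?_ ?_ <;>
    rw [interior_Ici] <;> intro w hw
  · exact (hasDerivAt_add_mul_log 1 (one_pos.trans hw)).hasDerivWithinAt
  · exact (hasDerivAt_log_add_one_add_mul_inv 1 (one_pos.trans hw)).hasDerivWithinAt
  · exact div_nonneg (sub_nonneg.2 (le_of_lt hw)) (by positivity)

lemma two_mul_mul_log_le {n u : ℝ} (hu : 1 ≤ u) (hun : u ≤ n) :
    2 * n * (u - 1) * Real.log n ≤ (u + n) * (n - 1) * Real.log u := by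
  rcases hu.eq_or_lt with rfl | hu
  · simp
  rcases hun.eq_or_lt with rfl | hun
  · apply le_of_eq; ring
  have h := (concaveOn_add_mul_log n).neg.secant_mono_aux1 (x := 1) (y := u) (z := n)
    ⟨le_rfl, by linarith⟩ ⟨by linarith, le_rfl⟩ hu hun
  simp only [Pi.neg_apply, Real.log_one] at h
  linarith

lemma add_one_mul_log_secant_mono {a b : ℝ} (ha : 1 ≤ a) (hab : a ≤ b) :
    (b - 1) * ((a + 1) * Real.log a) ≤ (a - 1) * ((b + 1) * Real.log b) := by
  rcases ha.eq_or_lt with rfl | ha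
  · simp
  rcases hab.eq_or_lt with rfl | hab
  · rfl
  have h := convexOn_add_one_mul_log.secant_mono_aux1 (x := 1) (y := a) (z := b)
    Set.self_mem_Ici (by simp; linarith) ha hab
  simp only [Real.log_one] at h
  linarith

lemma mul_sq_add_sub_one_le_mul_log {n u y : ℝ} (hn : 1 < n) (hu : 0 ≤ u) (hun : u ≤ n)
    (hy : 0 ≤ y) (hy1 : y * (n + 1) ≤ 1) (hyu : y * (n + u) ≤ 1) :
    n * Real.log n / (n - 1) * y * (u - 1) ^ 2 + (u - 1) ≤ u * Real.log u := by
  have hn1 : 0 < n - 1 := by linarith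
  have hL : 0 < Real.log n := Real.log_pos hn
  have hC : 0 < n * Real.log n / (n - 1) := by positivity
  rcases le_total u 1 with h1 | h1
  · have hK : n * Real.log n / (n - 1) * y ≤ 1 / 2 := by
      have h := two_mul_log_le_sub_inv hn.le
      have h2 : n * Real.log n / (n - 1) ≤ (n + 1) / 2 := by
        rw [div_le_iff₀ hn1]
        have := mul_le_mul_of_nonneg_left h (by linarith : 0 ≤ n)
        rw [mul_sub, mul_inv_cancel₀ (by linarith)] at this
        linarith
      nlinarith
    have hlog : (u ^ 2 - 1) / 2 ≤ u * Real.log u := by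
      rcases hu.eq_or_lt with rfl | hu
      · norm_num
      have h := two_mul_log_le_sub_inv ((one_le_inv₀ hu).2 h1)
      rw [Real.log_inv, inv_inv] at h
      have := mul_le_mul_of_nonneg_left h hu.le
      rw [mul_sub, mul_inv_cancel₀ hu.ne'] at this
      linarith
    nlinarith [mul_le_mul_of_nonneg_right hK (sq_nonneg (u - 1))]
  · have hlog := two_mul_sub_one_le_mul_log h1
    have hKu : n * Real.log n / (n - 1) * y * (u - 1) ≤ Real.log u / 2 := by
      have h := two_mul_mul_log_le h1 hun
      have h2 : n * Real.log n / (n - 1) * (u - 1) ≤ Real.log u / 2 * (n + u) := by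
        rw [div_mul_eq_mul_div, div_le_iff₀ hn1]
        linarith
      calc _ = y * (n * Real.log n / (n - 1) * (u - 1)) := by ring
        _ ≤ y * (Real.log u / 2 * (n + u)) := by gcongr
        _ = y * (n + u) * (Real.log u / 2) := by ring
        _ ≤ 1 * (Real.log u / 2) := by gcongr; exact div_nonneg (Real.log_nonneg h1) zero_le_two
        _ = _ := one_mul _
    nlinarith [mul_le_mul_of_nonneg_right hKu (sub_nonneg.2 h1)]

/-- The convexity gap of `t ↦ t * log t` at `y` dominates a quadratic. -/
lemma mul_sq_add_sub_le_mul_log_sub {n x t y : ℝ} (hn : 1 < n) (hx : 1 ≤ x * (n + 1))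
    (hy : n * y = 1 - x) (ht : 0 ≤ t) (htx : t ≤ x) (ht1 : t ≤ 1 - x) :
    n * Real.log n / (n - 1) * (t - y) ^ 2 + (t - y) ≤ t * Real.log t - t * Real.log y := by
  have hy0 : 0 ≤ y := by
    by_contra! h
    nlinarith
  rcases hy0.eq_or_lt with rfl | hy0
  · obtain rfl : t = 0 := by linarith
    simp
  rcases ht.eq_or_lt with rfl | ht'
  · have h := mul_sq_add_sub_one_le_mul_log hn le_rfl (by linarith) hy0.le (by nlinarith)
      (by nlinarith)
    simp only [zero_mul] at h ⊢
    nlinarith [mul_le_mul_of_nonneg_right h hy0.le]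
  have h := mul_sq_add_sub_one_le_mul_log (u := t / y) hn (by positivity)
    ((div_le_iff₀ hy0).2 (by linarith)) hy0.le (by nlinarith)
    (by rw [mul_add, mul_div_cancel₀ _ hy0.ne']; linarith)
  rw [Real.log_div ht'.ne' hy0.ne'] at h
  have h2 := mul_le_mul_of_nonneg_right h hy0.le
  have e : y * (t / y) = t := mul_div_cancel₀ _ hy0.ne'
  generalize t / y = u at *
  subst e
  nlinarith

lemma hasDerivAt_mul_sub_binEntropy (B : ℝ) {x : ℝ} (h0 : 0 < x) (h1 : x < 1) :
    HasDerivAt (fun x => B * (x - x ^ 2) - Real.binEntropy x)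
      (B * (1 - 2 * x) - (Real.log (1 - x) - Real.log x)) x := by
  refine ((((hasDerivAt_id x).sub (hasDerivAt_pow 2 x)).const_mul B).sub
    (Real.hasDerivAt_binEntropy h0.ne' h1.ne)).congr_deriv ?_
  simp

lemma monotoneOn_mul_sub_binEntropy {B a b : ℝ} (ha : 0 ≤ a) (hb : b ≤ 1)
    (h : ∀ x ∈ Set.Ioo a b, Real.log (1 - x) - Real.log x ≤ B * (1 - 2 * x)) :
    MonotoneOn (fun x => B * (x - x ^ 2) - Real.binEntropy x) (Set.Icc a b) := by
  refine monotoneOn_of_deriv_nonneg (convex_Icc _ _) (by fun_prop) ?_ ?_ <;>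
    rw [interior_Icc] <;> intro x hx <;>
    have hd := hasDerivAt_mul_sub_binEntropy B (ha.trans_lt hx.1) (hx.2.trans_le hb)
  · exact hd.differentiableAt.differentiableWithinAt
  · rw [hd.deriv]
    exact sub_nonneg.2 (h x hx)

lemma mul_sub_binEntropy_ge {n x : ℝ} (hn : 1 < n) (hx : 1 / (n + 1) ≤ x) (hx1 : x ≤ 1) :
    (n + 1) * Real.log n / (n - 1) * (1 / (n + 1) - (1 / (n + 1)) ^ 2) -
        Real.binEntropy (1 / (n + 1)) ≤
      (n + 1) * Real.log n / (n - 1) * (x - x ^ 2) - Real.binEntropy x := by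
  set B := (n + 1) * Real.log n / (n - 1) with hB
  have hn1 : 0 < n - 1 := by linarith
  have hnp : 0 < n + 1 := by linarith
  have hsymm : ∀ x, B * ((1 - x) - (1 - x) ^ 2) - Real.binEntropy (1 - x) =
      B * (x - x ^ 2) - Real.binEntropy x := fun x => by
    rw [Real.binEntropy_one_sub]; ring
  have hBn : B * (n - 1) = (n + 1) * Real.log n := by
    rw [hB]; field_simp
  have hhalf : 1 / (n + 1) ≤ (1 / 2 : ℝ) := by
    rw [div_le_div_iff₀ hnp two_pos]; linarith
  have m1 : MonotoneOn (fun x => B * (x - x ^ 2) - Real.binEntropy x)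
      (Set.Icc (1 / (n + 1)) (1 / 2)) := by
    refine monotoneOn_mul_sub_binEntropy (by positivity) (by norm_num) fun x ⟨hx, hx2⟩ => ?_
    have hx0 : 0 < x := lt_trans (by positivity) hx
    rw [div_lt_iff₀ hnp] at hx
    have h := add_one_mul_log_secant_mono (a := (1 - x) / x) (b := n)
      ((one_le_div hx0).2 (by linarith)) ((div_le_iff₀ hx0).2 (by linarith))
    rw [Real.log_div (by linarith) hx0.ne', ← hBn] at h
    have e1 : (1 - x) / x + 1 = 1 / x := by field_simp; ring
    have e2 : (1 - x) / x - 1 = (1 - 2 * x) / x := by field_simp; ring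
    rw [e1, e2] at h
    have h' := mul_le_mul_of_nonneg_right h (mul_pos hx0 (inv_pos.2 hn1)).le
    field_simp at h'
    linarith
  have m2 : MonotoneOn (fun x => B * (x - x ^ 2) - Real.binEntropy x)
      (Set.Icc (1 - 1 / (n + 1)) 1) := by
    refine monotoneOn_mul_sub_binEntropy (by linarith) le_rfl fun x ⟨hx, hx2⟩ => ?_
    have hx0 : 0 < 1 - x := by linarith
    have hx3 : (1 - x) * (n + 1) < 1 := by
      rw [← lt_div_iff₀ hnp]; linarith
    have h := add_one_mul_log_secant_mono (a := n) (b := x / (1 - x))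
      hn.le ((le_div_iff₀ hx0).2 (by linarith))
    rw [Real.log_div (by linarith) hx0.ne', ← hBn] at h
    have e1 : x / (1 - x) + 1 = 1 / (1 - x) := by field_simp; ring
    have e2 : x / (1 - x) - 1 = (2 * x - 1) / (1 - x) := by field_simp; ring
    rw [e1, e2] at h
    have h' := mul_le_mul_of_nonneg_right h (mul_pos hx0 (inv_pos.2 hn1)).le
    field_simp at h'
    linarith
  rcases le_total x (1 / 2) with h | h
  · exact m1 ⟨le_rfl, hhalf⟩ ⟨hx, h⟩ hx
  rcases le_total x (1 - 1 / (n + 1)) with h2 | h2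
  · rw [← hsymm x]
    exact m1 ⟨le_rfl, hhalf⟩ ⟨by linarith, by linarith⟩ (by linarith)
  · rw [← hsymm (1 / (n + 1))]
    have : 0 < 1 / (n + 1) := by positivity
    exact m2 ⟨le_rfl, by linarith⟩ ⟨h2, hx1⟩ h2

/-- The entropy bound for a distribution taking one value once and another `n` times. -/
lemma entropy_two_values {n x y : ℝ} (hn : 1 < n) (hx : 1 ≤ x * (n + 1)) (hx1 : x ≤ 1)
    (hy : n * y = 1 - x) :
    n * Real.log n / (n - 1) * (x ^ 2 + n * y ^ 2 - 1 / (n + 1)) ≤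
      x * Real.log x + n * (y * Real.log y) + Real.log (n + 1) := by
  have hn0 : 0 < n := by linarith
  have hn1 : 0 < n - 1 := by linarith
  have hnp : 0 < n + 1 := by linarith
  have h := mul_sub_binEntropy_ge hn ((div_le_iff₀ hnp).2 hx) hx1
  have e0 : 1 - 1 / (n + 1) = n / (n + 1) := by field_simp; ring
  have e1 : Real.binEntropy (1 / (n + 1)) = Real.log (n + 1) - n / (n + 1) * Real.log n := by
    rw [Real.binEntropy, e0, one_div, inv_inv, inv_div, Real.log_div hnp.ne' hn0.ne']
    field_simp
    ring
  have e2 : n * (y * Real.log y) = (1 - x) * Real.log (1 - x) - (1 - x) * Real.log n := by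
    rcases eq_or_ne y 0 with rfl | hy0
    · rw [← hy]; simp
    · rw [← hy, Real.log_mul hn0.ne' hy0]; ring
  rw [e1, Real.binEntropy, Real.log_inv, Real.log_inv] at h
  rw [e2]
  have e3 : y = (1 - x) / n := by field_simp; linarith
  have e4 : n * Real.log n / (n - 1) * (x ^ 2 + n * y ^ 2 - 1 / (n + 1)) =
      (n + 1) * Real.log n / (n - 1) * (1 / (n + 1) - (1 / (n + 1)) ^ 2) -
      (n + 1) * Real.log n / (n - 1) * (x - x ^ 2) + n / (n + 1) * Real.log n
      - (1 - x) * Real.log n := by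
    rw [e3]; field_simp; ring
  linarith

/-- The sharp comparison between entropy and the Euclidean norm of a probability vector. -/
lemma entropy_sq_bound {ι : Type*} [Fintype ι] {n : ℝ} (hn : 1 < n)
    (hcard : (Fintype.card ι : ℝ) = n + 1) {p : ι → ℝ} (hp : ∀ i, 0 ≤ p i)
    (hsum : ∑ i, p i = 1) :
    n * Real.log n / (n - 1) * (∑ i, p i ^ 2 - 1 / (n + 1)) ≤
      ∑ i, p i * Real.log (p i) + Real.log (n + 1) := by
  classical
  have : Nonempty ι := by
    by_contra h
    rw [not_nonempty_iff] at h
    simp at hsum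
  obtain ⟨m, hm⟩ := Finite.exists_max p
  have hx : 1 ≤ p m * (n + 1) := by
    have := Finset.sum_le_card_nsmul univ p (p m) fun i _ => hm i
    rw [hsum, nsmul_eq_mul, card_univ, hcard] at this
    linarith
  have split : ∀ f : ι → ℝ, ∑ i, f i = f m + ∑ i ∈ univ.erase m, f i := fun f =>
    (add_sum_erase univ f (mem_univ m)).symm
  have hrest : ∑ i ∈ univ.erase m, p i = 1 - p m := by linarith [split p]
  have hcard' : ((univ.erase m).card : ℝ) = n := by
    rw [card_erase_of_mem (mem_univ m), card_univ, Nat.cast_sub Fintype.card_pos, hcard]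
    simp
  have hx1 : p m ≤ 1 := by linarith [sum_nonneg fun i (_ : i ∈ univ.erase m) => hp i]
  obtain ⟨y, hy⟩ : ∃ y, n * y = 1 - p m := ⟨(1 - p m) / n, by field_simp⟩
  have key := sum_le_sum fun i (hi : i ∈ univ.erase m) =>
    mul_sq_add_sub_le_mul_log_sub hn hx hy (hp i) (hm i)
      (hrest ▸ single_le_sum (fun j _ => hp j) hi)
  simp only [sub_sq, sum_add_distrib, sum_sub_distrib, ← mul_sum, ← sum_mul, sum_const,
    nsmul_eq_mul, hcard', hrest] at key
  have e : ∑ i ∈ univ.erase m, 2 * p i * y = 2 * (1 - p m) * y := by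
    rw [← sum_mul, ← mul_sum, hrest]
  have h2 := entropy_two_values hn hx hx1 hy
  rw [split fun i => p i ^ 2, split fun i => p i * Real.log (p i)]
  rw [← hy] at *
  linarith

/-- **Achlioptas–Naor bound.**  For `k ≥ 3` and `0 ≤ ξ < 2 log(k-1)/(k-1)`, the function
`Φ(ω) = H(ω) - log k + (ξ/2)(‖ω‖_F² - 1)` over doubly stochastic `k × k` matrices is
maximized uniquely at `ω = J/k`: it is `≤ 0`, with equality iff `ω = J/k`. -/
theorem Phi_maximized_at_flat (k : ℕ) (hk : 3 ≤ k) (ξ : ℝ) (hξ0 : 0 ≤ ξ)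
    (hξ : ξ < 2 * Real.log (k - 1) / (k - 1)) :
    ∀ ω : Matrix (Fin k) (Fin k) ℝ, IsDoublyStochastic ω →
      Phi k ξ ω ≤ 0 ∧ (Phi k ξ ω = 0 ↔ ω = Matrix.of fun _ _ => 1 / (k : ℝ)) := by
  intro ω ⟨hω, hrow, _⟩
  have hk' : (3 : ℝ) ≤ k := by exact_mod_cast hk
  have hk0 : (0 : ℝ) < k := by linarith
  set n : ℝ := k - 1 with hn
  have hkn : (k : ℝ) = n + 1 := by rw [hn]; ring
  have hn1 : 1 < n := by linarith
  have hL := Real.log_pos hn1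
  set C := n * Real.log n / (n - 1) with hC
  have hCξ : k * ξ / 2 < C := by
    have h1 : k * ξ / 2 < (n + 1) * (Real.log n / n) := by
      rw [mul_div_assoc] at hξ
      rw [hkn]
      nlinarith
    have h2 : (n + 1) * (Real.log n / n) ≤ C := by
      rw [hC, ← mul_div_assoc, div_le_div_iff₀ (by linarith) (by linarith)]
      nlinarith
    linarith
  have hsq : ∀ s, ∑ t, (ω s t - 1 / k) ^ 2 = ∑ t, ω s t ^ 2 - 1 / k := fun s => by
    have e : ∑ t, 2 * ω s t * (1 / (k : ℝ)) = 2 * (1 / k) := by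
      rw [← sum_mul, ← mul_sum, hrow]; ring
    simp only [sub_sq, sum_add_distrib, sum_sub_distrib, e]
    simp
    field_simp
    ring
  have hrows : ∀ s, C * ∑ t, (ω s t - 1 / k) ^ 2 ≤
      ∑ t, ω s t * Real.log (ω s t) + Real.log k := fun s => by
    rw [hsq s, hkn]
    exact entropy_sq_bound hn1 (by simpa using hkn) (hω s) (hrow s)
  have hPhi : k * Phi k ξ ω = k * ξ / 2 * ∑ s, ∑ t, (ω s t - 1 / k) ^ 2 -
      ∑ s, (∑ t, ω s t * Real.log (ω s t) + Real.log k) := by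
    simp only [Phi, matEntropy, hsq, sum_add_distrib, sum_sub_distrib]
    simp
    field_simp
    ring
  have hbound : k * Phi k ξ ω ≤ -((C - k * ξ / 2) * ∑ s, ∑ t, (ω s t - 1 / k) ^ 2) := by
    have h := sum_le_sum fun s (_ : s ∈ univ) => hrows s
    rw [← mul_sum] at h
    rw [hPhi]
    linarith
  have hQ : 0 ≤ ∑ s, ∑ t, (ω s t - 1 / k) ^ 2 :=
    sum_nonneg fun s _ => sum_nonneg fun t _ => sq_nonneg _
  refine ⟨?_, fun h => ?_, ?_⟩
  · have := mul_nonneg (sub_nonneg.2 hCξ.le) hQ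
    by_contra! h
    nlinarith [mul_pos hk0 h]
  · rw [h, mul_zero] at hbound
    have hQ0 : ∑ s, ∑ t, (ω s t - 1 / k) ^ 2 = 0 := by
      refine le_antisymm ?_ hQ
      by_contra! h'
      nlinarith [mul_pos (sub_pos.2 hCξ) h']
    ext s t
    have h1 := (sum_eq_zero_iff_of_nonneg fun s _ => sum_nonneg fun t _ => sq_nonneg _).1 hQ0 s
      (mem_univ s)
    have h2 := (sum_eq_zero_iff_of_nonneg fun t _ => sq_nonneg _).1 h1 t (mem_univ t)
    simpa [sub_eq_zero] using h2
  · rintro rfl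
    have h : k * Phi k ξ (Matrix.of fun _ _ => 1 / (k : ℝ)) = 0 := by
      rw [hPhi]
      simp
      field_simp
      simp
    exact (mul_eq_zero.1 h).resolve_left hk0.ne'
end
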